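/- Let M be a von Neumann algebra on a complex Hilbert space 𝓗, and let V and W be strongly continuous one-parameter unitary groups on 𝓗, each with non-negative spectrum, such that V_t ∈ M and W_t ∈ M′ for all t ∈ ℝ. Set U_t := V_t W_t; then U is a strongly continuous one-parameter unitary group implementing the same automorphisms of M as V (U_t m U_t⁻¹ = V_t m V_t⁻¹ for m ∈ M). With 𝔙 := 𝔏_V and 𝔘 := 𝔏_U, one has the inclusion {m ∈ M : b·𝔙 ⊆ closed linear span of 𝔙·B(𝓗) for b ∈ {m, m*}} ⊆ {m ∈ M : b·𝔘 ⊆ closed linear span of 𝔘·B(𝓗) for b ∈ {m, m*}}. In particular, if (M,V) is a cross representation then (M,U) is a cross representation, and for any C*-subalgebra A ⊆ M invariant under both conjugation actions: if (A,V) is cross then (A,U) is cross. -/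

import Mathlib

open MeasureTheory Filter

noncomputable section

variable {H : Type*} [NormedAddCommGroup H] [InnerProductSpace ℂ H] [CompleteSpace H]

/-- The norm-closed *-subalgebra of `B(H)` generated by the integrated operators
`U(f) : ψ ↦ ∫ f(g) U_g ψ dμ(g)`, for `f ∈ L¹(G,μ)`. -/
def integratedAlgebra {G : Type*} [MeasurableSpace G] (μ : Measure G)
    (U : G → H →L[ℂ] H) : Set (H →L[ℂ] H) :=
  closure (↑(NonUnitalStarAlgebra.adjoin ℂ
    {T : H →L[ℂ] H | ∃ f : G → ℂ, Integrable f μ ∧ ∀ ψ : H, T ψ = ∫ g, f g • U g ψ ∂μ}) :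
    Set (H →L[ℂ] H))

/-- The closed linear span of `S · B(H)`. -/
def closedRightSpan (S : Set (H →L[ℂ] H)) : Set (H →L[ℂ] H) :=
  closure (↑(Submodule.span ℂ
    {x : H →L[ℂ] H | ∃ L ∈ S, ∃ B : H →L[ℂ] H, x = L * B}) : Set (H →L[ℂ] H))

/-- `(A, S)` is a cross representation: `A·S ⊆ closed span (S·B(H))`. -/
def IsCrossRep (A S : Set (H →L[ℂ] H)) : Prop :=
  ∀ a ∈ A, ∀ L ∈ S, a * L ∈ closedRightSpan S

/-- A strongly continuous unitary representation of a topological group. -/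
def IsUnitaryRep {G : Type*} [Group G] [TopologicalSpace G] (U : G → H →L[ℂ] H) : Prop :=
  (∀ g, U g ∈ unitary (H →L[ℂ] H)) ∧ (∀ g h, U (g * h) = U g * U h) ∧
    ∀ ψ : H, Continuous fun g => U g ψ

/-- A strongly continuous one-parameter unitary group. -/
def IsUnitaryOneParam (U : ℝ → H →L[ℂ] H) : Prop :=
  (∀ t, U t ∈ unitary (H →L[ℂ] H)) ∧ (∀ s t, U (s + t) = U s * U t) ∧
    ∀ ψ : H, Continuous fun t => U t ψ


/-- `f ∈ L¹(ℝ)` whose Fourier transform `λ ↦ ∫ f(t)e^{itλ} dt` vanishes for all `λ ≥ 0`. -/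
def NegSpectralFun (f : ℝ → ℂ) : Prop :=
  Integrable f ∧ ∀ l : ℝ, 0 ≤ l →
    (∫ t : ℝ, f t * Complex.exp (Complex.I * (t : ℂ) * (l : ℂ))) = 0

/-- `𝔏₋`: the closed linear span of `{U(f) : f ∈ L¹(ℝ), f̂ vanishes on [0,∞)}`
(the image of the ideal `C₀((−∞,0))` of `C*(ℝ)`). -/
def negPartAlgebra (U : ℝ → H →L[ℂ] H) : Set (H →L[ℂ] H) :=
  closure (↑(Submodule.span ℂ
    {T : H →L[ℂ] H | ∃ f : ℝ → ℂ, NegSpectralFun f ∧ ∀ ψ : H, T ψ = ∫ t, f t • U t ψ}) :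
    Set (H →L[ℂ] H))

/-- A one-parameter unitary group has non-negative spectrum if `U(f) = 0` for every
`f ∈ L¹(ℝ)` whose Fourier transform vanishes on `[0,∞)`. -/
def HasNonnegSpectrum (U : ℝ → H →L[ℂ] H) : Prop :=
  ∀ f : ℝ → ℂ, NegSpectralFun f → ∀ ψ : H, (∫ t, f t • U t ψ) = 0

open scoped Topology

lemma aux_integrable_inv_sq (a y : ℝ) (hy : y ≠ 0) :
    Integrable (fun s : ℝ => ((s - a) ^ 2 + y ^ 2)⁻¹) := by
  have h1 : Integrable (fun s : ℝ => (1 + (s / y) ^ 2)⁻¹) :=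
    (integrable_inv_one_add_sq).comp_div hy
  have h2 := (h1.comp_sub_right a).const_mul ((y ^ 2)⁻¹)
  refine h2.congr (Eventually.of_forall fun s => ?_)
  simp only
  rw [← mul_inv]
  congr 1
  field_simp
  ring

lemma aux_sub_ne {α : ℂ} (hα : α.im ≠ 0) (s : ℝ) : (s : ℂ) - α ≠ 0 := by
  intro h
  apply hα
  have := congrArg Complex.im h
  simpa using this

/-- The basic kernel `1/((s-α)(s-β))`. -/
def kap (α β : ℂ) (s : ℝ) : ℂ := ((s : ℂ) - α)⁻¹ * ((s : ℂ) - β)⁻¹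

lemma kap_continuous {α β : ℂ} (hα : α.im ≠ 0) (hβ : β.im ≠ 0) : Continuous (kap α β) := by
  unfold kap
  exact ((Complex.continuous_ofReal.sub continuous_const).inv₀ (aux_sub_ne hα)).mul
    ((Complex.continuous_ofReal.sub continuous_const).inv₀ (aux_sub_ne hβ))

lemma kap_integrable {α β : ℂ} (hα : α.im ≠ 0) (hβ : β.im ≠ 0) : Integrable (kap α β) := by
  refine Integrable.mono' (((aux_integrable_inv_sq α.re α.im hα).add
    (aux_integrable_inv_sq β.re β.im hβ))) (kap_continuous hα hβ).aestronglyMeasurable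
    (Eventually.of_forall fun s => ?_)
  have key : ∀ γ : ℂ, ((s - γ.re) ^ 2 + γ.im ^ 2)⁻¹ = (‖(s : ℂ) - γ‖⁻¹) ^ 2 := by
    intro γ
    rw [inv_pow, ← Complex.normSq_eq_norm_sq, Complex.normSq_apply]
    simp
    ring
  simp only [Pi.add_apply, key, kap, norm_mul, norm_inv]
  nlinarith [sq_nonneg (‖(s : ℂ) - α‖⁻¹ - ‖(s : ℂ) - β‖⁻¹), sq_nonneg (‖(s : ℂ) - α‖⁻¹),
    sq_nonneg (‖(s : ℂ) - β‖⁻¹)]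

lemma kap_neg {α β : ℂ} (hα : α.im < 0) (hβ : β.im < 0) : NegSpectralFun (kap α β) := by
  refine ⟨kap_integrable hα.ne hβ.ne, fun l hl => ?_⟩
  set h : ℂ → ℂ := fun z => (z - α)⁻¹ * (z - β)⁻¹ * Complex.exp (Complex.I * z * l) with hh
  have hne : ∀ γ : ℂ, γ.im < 0 → ∀ z : ℂ, 0 ≤ z.im → z - γ ≠ 0 := by
    intro γ hγ z hz h0
    have := congrArg Complex.im h0
    simp at this
    linarith
  have hexp : ∀ z : ℂ, 0 ≤ z.im → ‖Complex.exp (Complex.I * z * l)‖ ≤ 1 := by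
    intro z hz
    rw [Complex.norm_exp]
    simp
    positivity
  have hfint : Integrable (fun s : ℝ => h s) := by
    refine Integrable.mono (kap_integrable hα.ne hβ.ne)
      (Continuous.aestronglyMeasurable ?_) (Eventually.of_forall fun s => ?_)
    · exact (kap_continuous hα.ne hβ.ne).mul (by fun_prop)
    · simp only [hh, norm_mul (_ * _)]
      exact mul_le_of_le_one_right (norm_nonneg _) (hexp _ (by simp))
  have hlim := intervalIntegral_tendsto_integral hfint tendsto_neg_atTop_atBot tendsto_id
  refine tendsto_nhds_unique hlim ?_
  set K := 2 * max ‖α‖ ‖β‖ + 1 with hK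
  have hKpos : 0 < K := by have := norm_nonneg α; have := le_max_left ‖α‖ ‖β‖; linarith
  have hbd : ∀ R : ℝ, K ≤ R → ∀ z : ℂ, 0 ≤ z.im → R ≤ ‖z‖ → ‖h z‖ ≤ 4 / R ^ 2 := by
    intro R hR z hz hzR
    have h1 : ∀ γ : ℂ, ‖γ‖ ≤ max ‖α‖ ‖β‖ → ‖(z - γ)⁻¹‖ ≤ 2 / R := by
      intro γ hγ
      have : R / 2 ≤ ‖z - γ‖ := by
        have := norm_sub_norm_le z γ
        linarith
      rw [norm_inv]
      calc ‖z - γ‖⁻¹ ≤ (R / 2)⁻¹ := by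
            apply inv_anti₀ _ this
            linarith
        _ = 2 / R := by rw [inv_div]
    calc ‖h z‖ = ‖(z - α)⁻¹‖ * ‖(z - β)⁻¹‖ * ‖Complex.exp (Complex.I * z * l)‖ := by
          simp [hh]
      _ ≤ (2 / R) * (2 / R) * 1 := by
          have hR0 : 0 < R := by linarith
          gcongr
          · exact h1 α (le_max_left _ _)
          · exact h1 β (le_max_right _ _)
          · exact hexp z hz
      _ = 4 / R ^ 2 := by ring
  refine squeeze_zero_norm' (a := fun R : ℝ => 16 * R⁻¹) ?_ ?_
  swap
  · simpa using (tendsto_inv_atTop_zero (𝕜 := ℝ)).const_mul 16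
  filter_upwards [eventually_ge_atTop K] with R hR
  have hR0 : 0 < R := by linarith
  have hrect := Complex.integral_boundary_rect_eq_zero_of_differentiableOn h
    (((-R : ℝ) : ℂ)) (R + R * Complex.I) (by
      intro z hz
      have hz' : 0 ≤ z.im := by
        have := hz.2
        simp [Set.uIcc_of_le hR0.le] at this
        exact this.1
      have a1 := hne α hα z hz'
      have a2 := hne β hβ z hz'
      apply DifferentiableAt.differentiableWithinAt
      exact (((differentiableAt_id.sub_const α).inv a1).mul
        ((differentiableAt_id.sub_const β).inv a2)).mul (by fun_prop))
  simp only [Complex.ofReal_re, Complex.ofReal_im, Complex.add_re, Complex.add_im,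
    Complex.mul_re, Complex.mul_im, Complex.I_re, Complex.I_im, mul_zero, mul_one, zero_mul,
    sub_zero, add_zero, zero_add, Complex.ofReal_zero] at hrect
  have b1 : ‖∫ x : ℝ in (-R)..R, h (x + R * Complex.I)‖ ≤ 4 / R ^ 2 * |R - (-R)| := by
    apply intervalIntegral.norm_integral_le_of_norm_le_const
    intro x hx
    apply hbd R hR _ (by simpa using hR0.le)
    have := Complex.abs_im_le_norm (x + R * Complex.I)
    simp at this
    exact (le_abs_self _).trans this
  have b2 : ‖∫ y : ℝ in (0)..R, h (R + y * Complex.I)‖ ≤ 4 / R ^ 2 * |R - 0| := by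
    apply intervalIntegral.norm_integral_le_of_norm_le_const
    intro y hy
    rw [Set.uIoc_of_le hR0.le] at hy
    apply hbd R hR _ (by simpa using hy.1.le)
    have := Complex.abs_re_le_norm (R + y * Complex.I)
    simp at this
    exact (le_abs_self _).trans this
  have b3 : ‖∫ y : ℝ in (0)..R, h (((-R : ℝ) : ℂ) + y * Complex.I)‖ ≤ 4 / R ^ 2 * |R - 0| := by
    apply intervalIntegral.norm_integral_le_of_norm_le_const
    intro y hy
    rw [Set.uIoc_of_le hR0.le] at hy
    apply hbd R hR _ (by simpa using hy.1.le)
    have := Complex.abs_re_le_norm (((-R : ℝ) : ℂ) + y * Complex.I)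
    simp at this
    exact (le_abs_self _).trans (by simpa using this)
  have e : (∫ x : ℝ in (-R)..R, h x) = (∫ x : ℝ in (-R)..R, h (x + R * Complex.I))
      - Complex.I • (∫ y : ℝ in (0)..R, h (R + y * Complex.I))
      + Complex.I • (∫ y : ℝ in (0)..R, h (((-R : ℝ) : ℂ) + y * Complex.I)) := by
    linear_combination hrect
  have e2 : ‖∫ x : ℝ in (-R)..R, h x‖ ≤ 4 / R ^ 2 * |R - (-R)| + 4 / R ^ 2 * |R - 0|
      + 4 / R ^ 2 * |R - 0| := by
    rw [e]
    refine (norm_add_le _ _).trans (add_le_add ((norm_sub_le _ _).trans (add_le_add b1 ?_)) ?_)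
    · rw [norm_smul, Complex.norm_I, one_mul]; exact b2
    · rw [norm_smul, Complex.norm_I, one_mul]; exact b3
  refine e2.trans (le_of_eq ?_)
  rw [sub_neg_eq_add, sub_zero, abs_of_pos hR0, abs_of_pos (by linarith)]
  field_simp
  norm_num

/-- Poisson kernel. -/
def poi (ε : ℝ) (t : ℝ) : ℂ := (((Real.pi)⁻¹ * (ε * (t ^ 2 + ε ^ 2)⁻¹) : ℝ) : ℂ)

lemma poi_eq {ε : ℝ} (hε : 0 < ε) (t : ℝ) :
    poi ε t = ((Real.pi : ℂ)⁻¹ * ε) * (((t : ℂ) - Complex.I * ε)⁻¹ * ((t : ℂ) + Complex.I * ε)⁻¹) := by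
  unfold poi
  push_cast
  rw [mul_assoc, ← mul_inv]
  congr 3
  linear_combination ((ε : ℂ)^2) * Complex.I_sq

lemma poi_continuous {ε : ℝ} (hε : 0 < ε) : Continuous (poi ε) := by
  unfold poi
  refine Complex.continuous_ofReal.comp (continuous_const.mul (continuous_const.mul
    (Continuous.inv₀ (by fun_prop) fun t => ?_)))
  positivity

lemma poi_integrable {ε : ℝ} (hε : 0 < ε) : Integrable (poi ε) := by
  have := aux_integrable_inv_sq 0 ε hε.ne'
  simp only [sub_zero] at this
  exact ((this.const_mul ε).const_mul _).ofReal

lemma poi_scale {ε : ℝ} (hε : 0 < ε) (x : ℝ) : poi ε (ε * x) = (ε : ℂ)⁻¹ * poi 1 x := by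
  have h : (Real.pi)⁻¹ * (ε * ((ε * x) ^ 2 + ε ^ 2)⁻¹)
    = ε⁻¹ * ((Real.pi)⁻¹ * (1 * (x ^ 2 + 1 ^ 2)⁻¹)) := by
    have : x ^ 2 + 1 ≠ 0 := by positivity
    have : (ε * x) ^ 2 + ε ^ 2 ≠ 0 := by positivity
    field_simp
  unfold poi
  rw [h]
  push_cast
  rfl

lemma poi_one_integral : ∫ x, poi 1 x = 1 := by
  unfold poi
  rw [integral_complex_ofReal]
  have : (∫ x : ℝ, (Real.pi)⁻¹ * (1 * (x ^ 2 + 1 ^ 2)⁻¹)) = 1 := by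
    rw [integral_const_mul]
    have : (∫ x : ℝ, (1 * (x ^ 2 + 1 ^ 2)⁻¹)) = Real.pi := by
      rw [← integral_univ_inv_one_add_sq]
      congr 1
      ext x
      rw [one_mul, one_pow, add_comm]
    rw [this]
    exact inv_mul_cancel₀ Real.pi_ne_zero
  rw [this]
  norm_num

lemma poi_smul_integral {E : Type*} [NormedAddCommGroup E] [NormedSpace ℂ E]
    {ε : ℝ} (hε : 0 < ε) (F : ℝ → E) :
    ∫ t, poi ε t • F t = ∫ x, poi 1 x • F (ε * x) := by
  have := Measure.integral_comp_mul_left (fun t => poi ε t • F t) ε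
  rw [abs_of_pos (inv_pos.2 hε)] at this
  simp only [poi_scale hε, mul_smul] at this
  have h2 : ∀ v : E, ε⁻¹ • v = ((ε : ℂ)⁻¹) • v := by
    intro v
    rw [← Complex.ofReal_inv, Complex.coe_smul]
  rw [integral_smul, h2] at this
  have hne : ((ε : ℂ)⁻¹) ≠ 0 := inv_ne_zero (by exact_mod_cast hε.ne')
  exact (smul_right_injective E hne this).symm

lemma poi_integral {ε : ℝ} (hε : 0 < ε) : ∫ x, poi ε x = 1 := by
  have := poi_smul_integral hε (fun _ => (1 : ℂ))
  simpa [poi_one_integral] using this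

lemma poi_approx {E : Type*} [NormedAddCommGroup E] [NormedSpace ℂ E] [CompleteSpace E]
    (F : ℝ → E) (hF : Continuous F) (C : ℝ) (hC : ∀ t, ‖F t‖ ≤ C) :
    Tendsto (fun ε => ∫ t, poi ε t • F t) (𝓝[>] 0) (𝓝 (F 0)) := by
  have h1 : Tendsto (fun ε : ℝ => ∫ x, poi 1 x • F (ε * x)) (𝓝[>] 0)
      (𝓝 (∫ x, poi 1 x • F 0)) := by
    refine tendsto_integral_filter_of_dominated_convergence (fun x => ‖poi 1 x‖ * C) ?_ ?_ ?_ ?_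
    · refine Eventually.of_forall fun ε => Continuous.aestronglyMeasurable ?_
      exact (poi_continuous one_pos).smul (hF.comp (by fun_prop))
    · refine Eventually.of_forall fun ε => Eventually.of_forall fun x => ?_
      rw [norm_smul]
      exact mul_le_mul_of_nonneg_left (hC _) (norm_nonneg _)
    · exact (poi_integrable one_pos).norm.mul_const C
    · refine Eventually.of_forall fun x => ?_
      refine Tendsto.const_smul ?_ _
      have : Tendsto (fun ε : ℝ => F (ε * x)) (𝓝 0) (𝓝 (F (0 * x))) :=
        (hF.comp (continuous_mul_const x)).tendsto 0
      rw [zero_mul] at this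
      exact this.mono_left nhdsWithin_le_nhds
  rw [integral_smul_const, poi_one_integral, one_smul] at h1
  refine h1.congr' ?_
  filter_upwards [self_mem_nhdsWithin] with ε hε
  exact (poi_smul_integral hε F).symm

lemma poi_neg_arg (ε t : ℝ) : poi ε (-t) = poi ε t := by
  unfold poi
  simp

lemma poi_conj (ε t : ℝ) : star (poi ε t) = poi ε t := by
  unfold poi
  simp

lemma oneParam_norm_apply {U : ℝ → H →L[ℂ] H} (hU : IsUnitaryOneParam U) (t : ℝ) (ψ : H) :
    ‖U t ψ‖ = ‖ψ‖ := by
  have h : star (U t) * U t = 1 := Unitary.star_mul_self_of_mem (hU.1 t)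
  have h2 : ‖U t ψ‖ ^ 2 = ‖ψ‖ ^ 2 := by
    rw [← inner_self_eq_norm_sq (𝕜 := ℂ), ← inner_self_eq_norm_sq (𝕜 := ℂ),
      ← ContinuousLinearMap.adjoint_inner_right]
    rw [← ContinuousLinearMap.star_eq_adjoint, ← mul_apply_eq_comp, h]
    simp
  exact (pow_left_inj₀ (norm_nonneg _) (norm_nonneg _) two_ne_zero).1 h2

lemma oneParam_zero {U : ℝ → H →L[ℂ] H} (hU : IsUnitaryOneParam U) : U 0 = 1 := by
  have h := hU.2.1 0 0
  rw [add_zero] at h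
  have h2 : star (U 0) * U 0 = 1 := Unitary.star_mul_self_of_mem (hU.1 0)
  calc U 0 = star (U 0) * U 0 * U 0 := by rw [h2, one_mul]
    _ = star (U 0) * (U 0 * U 0) := mul_assoc _ _ _
    _ = star (U 0) * U 0 := by rw [← h]
    _ = 1 := h2

lemma oneParam_star {U : ℝ → H →L[ℂ] H} (hU : IsUnitaryOneParam U) (t : ℝ) :
    star (U t) = U (-t) := by
  have h2 : star (U t) * U t = 1 := Unitary.star_mul_self_of_mem (hU.1 t)
  have h3 : U t * U (-t) = 1 := by rw [← hU.2.1, add_neg_cancel, oneParam_zero hU]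
  calc star (U t) = star (U t) * (U t * U (-t)) := by rw [h3, mul_one]
    _ = star (U t) * U t * U (-t) := (mul_assoc _ _ _).symm
    _ = U (-t) := by rw [h2, one_mul]

lemma oneParam_norm_mul {U : ℝ → H →L[ℂ] H} (hU : IsUnitaryOneParam U) (t : ℝ)
    (T : H →L[ℂ] H) : ‖U t * T‖ ≤ ‖T‖ := by
  refine ContinuousLinearMap.opNorm_le_bound _ (norm_nonneg _) fun ψ => ?_
  rw [mul_apply_eq_comp, oneParam_norm_apply hU]
  exact T.le_opNorm ψ

lemma intOp_integrable {U : ℝ → H →L[ℂ] H} (hU : IsUnitaryOneParam U) {f : ℝ → ℂ}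
    (hf : Integrable f) (ψ : H) : Integrable (fun t => f t • U t ψ) := by
  refine Integrable.mono (hf.smul_const ψ)
    (hf.aestronglyMeasurable.smul (hU.2.2 ψ).aestronglyMeasurable)
    (Eventually.of_forall fun t => ?_)
  simp only [norm_smul, oneParam_norm_apply hU]
  exact le_rfl

/-- The integrated operator `U(f)`. -/
def intOp {U : ℝ → H →L[ℂ] H} (hU : IsUnitaryOneParam U) {f : ℝ → ℂ}
    (hf : Integrable f) : H →L[ℂ] H :=
  LinearMap.mkContinuous
    { toFun := fun ψ => ∫ t, f t • U t ψ
      map_add' := fun x y => by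
        simp only [map_add, smul_add]
        exact integral_add (intOp_integrable hU hf x) (intOp_integrable hU hf y)
      map_smul' := fun c x => by
        simp only [map_smul, RingHom.id_apply]
        rw [← integral_smul]
        congr 1
        ext t
        rw [smul_comm] } (∫ t, ‖f t‖) (fun x => by
      simp only [LinearMap.coe_mk, AddHom.coe_mk]
      refine (norm_integral_le_integral_norm _).trans ?_
      simp only [norm_smul, oneParam_norm_apply hU]
      rw [integral_mul_const])

lemma intOp_apply {U : ℝ → H →L[ℂ] H} (hU : IsUnitaryOneParam U) {f : ℝ → ℂ}
    (hf : Integrable f) (ψ : H) : intOp hU hf ψ = ∫ t, f t • U t ψ := rfl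

lemma intOp_norm_le {U : ℝ → H →L[ℂ] H} (hU : IsUnitaryOneParam U) {f : ℝ → ℂ}
    (hf : Integrable f) : ‖intOp hU hf‖ ≤ ∫ t, ‖f t‖ :=
  LinearMap.mkContinuous_norm_le _ (integral_nonneg fun _ => norm_nonneg _) _

lemma intOp_mem {U : ℝ → H →L[ℂ] H} (hU : IsUnitaryOneParam U) {f : ℝ → ℂ}
    (hf : Integrable f) : intOp hU hf ∈ integratedAlgebra (volume : Measure ℝ) U :=
  subset_closure (NonUnitalStarAlgebra.subset_adjoin ℂ _ ⟨f, hf, fun ψ => intOp_apply hU hf ψ⟩)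

lemma intOp_comm {U : ℝ → H →L[ℂ] H} (hU : IsUnitaryOneParam U) {f : ℝ → ℂ}
    (hf : Integrable f) (T : H →L[ℂ] H) (hT : ∀ t, T * U t = U t * T) :
    T * intOp hU hf = intOp hU hf * T := by
  ext ψ
  simp only [mul_apply_eq_comp, intOp_apply]
  rw [← ContinuousLinearMap.integral_comp_comm _ (intOp_integrable hU hf ψ)]
  congr 1
  ext t
  rw [map_smul, ← mul_apply_eq_comp, hT, mul_apply_eq_comp]

lemma intOp_star {U : ℝ → H →L[ℂ] H} (hU : IsUnitaryOneParam U) {f : ℝ → ℂ}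
    (hf : Integrable f) (hg : Integrable (fun t => star (f (-t)))) :
    star (intOp hU hf) = intOp hU hg := by
  rw [ContinuousLinearMap.star_eq_adjoint]
  symm
  rw [ContinuousLinearMap.eq_adjoint_iff]
  intro x y
  rw [intOp_apply, intOp_apply, ← integral_inner (intOp_integrable hU hf y)]
  have h1 : inner ℂ (∫ t, star (f (-t)) • U t x) y
      = ∫ t, inner ℂ (star (f (-t)) • U t x) y := by
    rw [← inner_conj_symm, ← integral_inner (intOp_integrable hU hg x), ← integral_conj]
    congr 1
    ext t
    rw [inner_conj_symm]
  rw [h1, ← integral_neg_eq_self]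
  congr 1
  ext t
  rw [neg_neg, inner_smul_left, inner_smul_right, ← oneParam_star hU,
    ContinuousLinearMap.star_eq_adjoint, ContinuousLinearMap.adjoint_inner_left]
  simp

lemma aux_translation {f : ℝ → ℂ} (hf : Integrable f) :
    Tendsto (fun s : ℝ => ∫ t, ‖f (-s + t) - f t‖) (𝓝 0) (𝓝 0) := by
  have hm : MemLp f 1 volume := memLp_one_iff_integrable.2 hf
  have : Fact ((1 : ENNReal) ≠ ⊤) := ⟨ENNReal.one_ne_top⟩
  set F : Lp ℂ 1 (volume : Measure ℝ) := hm.toLp f with hF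
  have hc : Continuous (fun s : ℝ => (DomAddAct.mk (-s)) +ᵥ F) :=
    (DomAddAct.continuous_mk.comp continuous_neg).vadd continuous_const
  have h0 : Tendsto (fun s : ℝ => ‖((DomAddAct.mk (-s)) +ᵥ F) - F‖) (𝓝 0) (𝓝 0) := by
    have := (hc.sub (continuous_const (y := F))).norm.tendsto 0
    simpa using this
  refine h0.congr fun s => ?_
  rw [hF, DomAddAct.mk_vadd_toLp, ← MemLp.toLp_sub, Lp.norm_toLp,
    eLpNorm_one_eq_lintegral_enorm]
  exact (integral_norm_eq_lintegral_enorm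
    ((hf.comp_add_left (-s)).sub hf).aestronglyMeasurable).symm

/-- Norm continuity domain. -/
def NC (U : ℝ → H →L[ℂ] H) : Set (H →L[ℂ] H) :=
  {T | Tendsto (fun t => ‖U t * T - T‖) (𝓝 0) (𝓝 0)}

lemma NC_mul {U : ℝ → H →L[ℂ] H} {T : H →L[ℂ] H} (hT : T ∈ NC U) (B : H →L[ℂ] H) :
    T * B ∈ NC U := by
  have h : Tendsto (fun t => ‖U t * T - T‖ * ‖B‖) (𝓝 0) (𝓝 0) := by
    simpa using Tendsto.mul_const ‖B‖ hT
  refine squeeze_zero (fun _ => norm_nonneg _) (fun t => ?_) h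
  rw [← mul_assoc, ← sub_mul]
  exact norm_mul_le _ _

lemma NC_add {U : ℝ → H →L[ℂ] H} {S T : H →L[ℂ] H} (hS : S ∈ NC U) (hT : T ∈ NC U) :
    S + T ∈ NC U := by
  have h : Tendsto (fun t => ‖U t * S - S‖ + ‖U t * T - T‖) (𝓝 0) (𝓝 0) := by
    simpa using Tendsto.add hS hT
  refine squeeze_zero (fun _ => norm_nonneg _) (fun t => ?_) h
  rw [mul_add, add_sub_add_comm]
  exact norm_add_le _ _

lemma NC_zero {U : ℝ → H →L[ℂ] H} : (0 : H →L[ℂ] H) ∈ NC U := by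
  simp [NC]

lemma NC_smul {U : ℝ → H →L[ℂ] H} {T : H →L[ℂ] H} (hT : T ∈ NC U) (c : ℂ) :
    c • T ∈ NC U := by
  have := NC_mul hT (c • 1)
  simpa using this

lemma NC_closed {U : ℝ → H →L[ℂ] H} (hU : IsUnitaryOneParam U) : IsClosed (NC U) := by
  rw [← closure_subset_iff_isClosed]
  intro T hT
  rw [Metric.mem_closure_iff] at hT
  change Tendsto _ _ _
  rw [Metric.tendsto_nhds]
  intro e he
  obtain ⟨S, hS, hTS⟩ := hT (e / 4) (by positivity)
  have hS' : Tendsto (fun t => ‖U t * S - S‖) (𝓝 0) (𝓝 0) := hS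
  rw [Metric.tendsto_nhds] at hS'
  filter_upwards [hS' (e / 4) (by positivity)] with t ht
  rw [dist_eq_norm] at hTS
  simp only [dist_zero_right, norm_norm] at ht ⊢
  have e1 : U t * T - T = U t * (T - S) + (U t * S - S) - (T - S) := by
    rw [mul_sub]; abel
  rw [e1]
  have := norm_sub_le (U t * (T - S) + (U t * S - S)) (T - S)
  have := norm_add_le (U t * (T - S)) (U t * S - S)
  have := oneParam_norm_mul hU t (T - S)
  linarith

lemma intOp_NC {U : ℝ → H →L[ℂ] H} (hU : IsUnitaryOneParam U) {f : ℝ → ℂ}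
    (hf : Integrable f) : intOp hU hf ∈ NC U := by
  refine squeeze_zero (fun _ => norm_nonneg _) (fun s => ?_) (aux_translation hf)
  have hf2 : Integrable (fun t => f (-s + t)) := hf.comp_add_left (-s)
  have e : U s * intOp hU hf - intOp hU hf = intOp hU (hf2.sub hf) := by
    ext ψ
    simp only [sub_apply, mul_apply_eq_comp, intOp_apply,
      Pi.sub_apply, sub_smul]
    rw [integral_sub (intOp_integrable hU hf2 ψ) (intOp_integrable hU hf ψ)]
    congr 1
    rw [← ContinuousLinearMap.integral_comp_comm _ (intOp_integrable hU hf ψ)]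
    rw [← integral_add_left_eq_self (fun t => f (-s + t) • U t ψ) s]
    congr 1
    ext t
    rw [map_smul, hU.2.1, neg_add_cancel_left]
    rfl
  rw [e]
  exact intOp_norm_le hU _

/-- A closed right ideal (as a set) containing all `U(f)` contains the whole algebra. -/
lemma integratedAlgebra_induction {U : ℝ → H →L[ℂ] H} (hU : IsUnitaryOneParam U)
    {V : ℝ → H →L[ℂ] H} (hV : IsUnitaryOneParam V)
    (h : ∀ (f : ℝ → ℂ) (hf : Integrable f), intOp hU hf ∈ NC V) :
    integratedAlgebra (volume : Measure ℝ) U ⊆ NC V := by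
  refine closure_minimal ?_ (NC_closed hV)
  intro T hT
  have hT' : T ∈ NonUnitalAlgebra.adjoin ℂ ({T : H →L[ℂ] H | ∃ f : ℝ → ℂ, Integrable f ∧
      ∀ ψ : H, T ψ = ∫ g, f g • U g ψ} ∪ star {T : H →L[ℂ] H | ∃ f : ℝ → ℂ, Integrable f ∧
      ∀ ψ : H, T ψ = ∫ g, f g • U g ψ}) := hT
  induction hT' using NonUnitalAlgebra.adjoin_induction with
  | mem x hx =>
    rcases hx with ⟨f, hf, hx⟩ | ⟨f, hf, hx⟩
    · have : x = intOp hU hf := by ext ψ; rw [hx, intOp_apply]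
      rw [this]; exact h f hf
    · have h1 : star x = intOp hU hf := by ext ψ; rw [hx, intOp_apply]
      have hg : Integrable (fun t => star (f (-t))) :=
        (RCLike.conjCLE (K := ℂ)).toContinuousLinearMap.integrable_comp hf.comp_neg
      have : x = intOp hU hg := by rw [← intOp_star hU hf hg, ← h1, star_star]
      rw [this]; exact h _ hg
  | add x y hx hy ihx ihy => exact NC_add (ihx hx) (ihy hy)
  | zero => exact NC_zero
  | mul x y hx hy ihx ihy => exact NC_mul (ihx hx) y
  | smul c x hx ih => exact NC_smul (ih hx) c

lemma integratedAlgebra_NC {U : ℝ → H →L[ℂ] H} (hU : IsUnitaryOneParam U) :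
    integratedAlgebra (volume : Measure ℝ) U ⊆ NC U :=
  integratedAlgebra_induction hU hU fun _ hf => intOp_NC hU hf

/-- left multiplication by `m` sends the closed right span into `NC`. -/
lemma closedRightSpan_mul {V : ℝ → H →L[ℂ] H} (hV : IsUnitaryOneParam V)
    {S : Set (H →L[ℂ] H)} (m : H →L[ℂ] H) (h : ∀ L ∈ S, m * L ∈ NC V) :
    ∀ T ∈ closedRightSpan S, m * T ∈ NC V := by
  have hsub : closedRightSpan S ⊆ {T | m * T ∈ NC V} := by
    refine closure_minimal ?_ ((NC_closed hV).preimage (continuous_const_mul m))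
    intro T hT
    induction hT using Submodule.span_induction with
    | mem x hx =>
      obtain ⟨L, hL, B, rfl⟩ := hx
      change m * (L * B) ∈ NC V
      rw [← mul_assoc]
      exact NC_mul (h L hL) B
    | zero => change m * 0 ∈ NC V; rw [mul_zero]; exact NC_zero
    | add x y _ _ hx hy => change m * (x + y) ∈ NC V; rw [mul_add]; exact NC_add hx hy
    | smul c x _ hx =>
      have hx' : m * x ∈ NC V := hx
      have e : m * (c • x) = c • (m * x) := ContinuousLinearMap.ext fun ψ => by
        simp
      change m * (c • x) ∈ NC V
      rw [e]
      exact NC_smul hx' c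
  exact fun T hT => hsub hT

lemma NC_approx {U : ℝ → H →L[ℂ] H} (hU : IsUnitaryOneParam U) {T : H →L[ℂ] H}
    (hT : T ∈ NC U) :
    Tendsto (fun ε : ℝ => ∫ t, poi ε t • (U t * T)) (𝓝[>] 0) (𝓝 T) := by
  have hc : Continuous (fun t => U t * T) := by
    rw [continuous_iff_continuousAt]
    intro t₀
    rw [ContinuousAt, tendsto_iff_norm_sub_tendsto_zero]
    have h1 : Tendsto (fun t : ℝ => t - t₀) (𝓝 t₀) (𝓝 0) := by
      have : Continuous (fun t : ℝ => t - t₀) := by fun_prop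
      simpa using this.tendsto t₀
    have hT' : Tendsto (fun t => ‖U t * T - T‖) (𝓝 0) (𝓝 0) := hT
    refine squeeze_zero (fun _ => norm_nonneg _) (fun t => ?_) (hT'.comp h1)
    have : U t * T - U t₀ * T = U t₀ * (U (t - t₀) * T - T) := by
      rw [mul_sub, ← mul_assoc, ← hU.2.1, add_sub_cancel]
    rw [this]
    exact oneParam_norm_mul hU _ _
  have := poi_approx (fun t => U t * T) hc ‖T‖ (fun t => oneParam_norm_mul hU t T)
  simpa [oneParam_zero hU] using this

lemma intOp_mul_eq {U : ℝ → H →L[ℂ] H} (hU : IsUnitaryOneParam U) {T : H →L[ℂ] H}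
    (hT : T ∈ NC U) :
    ∃ g : ℝ → (H →L[ℂ] H), (∀ ε (hε : 0 < ε), g ε = intOp hU (poi_integrable hε) * T) ∧
      Tendsto g (𝓝[>] 0) (𝓝 T) := by
  refine ⟨_, ?_, NC_approx hU hT⟩
  intro ε hε
  have hc : Continuous (fun t => U t * T) := by
    rw [continuous_iff_continuousAt]
    intro t₀
    rw [ContinuousAt, tendsto_iff_norm_sub_tendsto_zero]
    have h1 : Tendsto (fun t : ℝ => t - t₀) (𝓝 t₀) (𝓝 0) := by
      have : Continuous (fun t : ℝ => t - t₀) := by fun_prop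
      simpa using this.tendsto t₀
    have hT' : Tendsto (fun t => ‖U t * T - T‖) (𝓝 0) (𝓝 0) := hT
    refine squeeze_zero (fun _ => norm_nonneg _) (fun t => ?_) (hT'.comp h1)
    have : U t * T - U t₀ * T = U t₀ * (U (t - t₀) * T - T) := by
      rw [mul_sub, ← mul_assoc, ← hU.2.1, add_sub_cancel]
    rw [this]
    exact oneParam_norm_mul hU _ _
  have hi : Integrable (fun t => poi ε t • (U t * T)) := by
    refine Integrable.mono' ((poi_integrable hε).norm.mul_const ‖T‖)
      ((poi_continuous hε).smul hc).aestronglyMeasurable (Eventually.of_forall fun t => ?_)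
    rw [norm_smul]
    exact mul_le_mul_of_nonneg_left (oneParam_norm_mul hU t T) (norm_nonneg _)
  ext ψ
  rw [ContinuousLinearMap.integral_apply hi, mul_apply_eq_comp, intOp_apply]
  rfl

lemma NC_subset_closedRightSpan {U : ℝ → H →L[ℂ] H} (hU : IsUnitaryOneParam U) :
    NC U ⊆ closedRightSpan (integratedAlgebra (volume : Measure ℝ) U) := by
  intro T hT
  obtain ⟨g, hg, hlim⟩ := intOp_mul_eq hU hT
  refine mem_closure_of_tendsto hlim ?_
  filter_upwards [self_mem_nhdsWithin] with ε hε
  rw [hg ε hε]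
  exact Submodule.subset_span ⟨_, intOp_mem hU _, T, rfl⟩

lemma closedRightSpan_subset_NC {U : ℝ → H →L[ℂ] H} (hU : IsUnitaryOneParam U) :
    closedRightSpan (integratedAlgebra (volume : Measure ℝ) U) ⊆ NC U := by
  intro T hT
  have := closedRightSpan_mul hU 1 (S := integratedAlgebra (volume : Measure ℝ) U)
    (fun L hL => by rw [one_mul]; exact integratedAlgebra_NC hU hL) T hT
  rwa [one_mul] at this

lemma NegSpectralFun_comb {f g : ℝ → ℂ} (hf : NegSpectralFun f) (hg : NegSpectralFun g)
    (a b : ℂ) : NegSpectralFun (fun t => a * f t + b * g t) := by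
  refine ⟨(hf.1.const_mul a).add (hg.1.const_mul b), fun l hl => ?_⟩
  have hexp : ∀ k : ℝ → ℂ, Integrable k →
      Integrable (fun t : ℝ => k t * Complex.exp (Complex.I * (t : ℂ) * (l : ℂ))) := by
    intro k hk
    refine Integrable.mono hk (hk.aestronglyMeasurable.mul
      (Continuous.aestronglyMeasurable (by fun_prop))) (Eventually.of_forall fun t => ?_)
    have : ‖Complex.exp (Complex.I * (t : ℂ) * (l : ℂ))‖ = 1 := by
      rw [Complex.norm_exp]; simp
    rw [norm_mul, this, mul_one]
  have e : ∀ t : ℝ, (a * f t + b * g t) * Complex.exp (Complex.I * (t : ℂ) * (l : ℂ))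
      = a * (f t * Complex.exp (Complex.I * (t : ℂ) * (l : ℂ)))
        + b * (g t * Complex.exp (Complex.I * (t : ℂ) * (l : ℂ))) := fun t => by ring
  simp only [e]
  rw [integral_add ((hexp f hf.1).const_mul a) ((hexp g hg.1).const_mul b),
    integral_const_mul, integral_const_mul, hf.2 l hl, hg.2 l hl]
  simp

/-- `q` kernel, with poles in the upper half plane. -/
def qk (τ η : ℝ) : ℝ → ℂ := kap (Complex.I * η) (Complex.I * η + τ)

lemma qk_continuous (τ : ℝ) {η : ℝ} (hη : 0 < η) : Continuous (qk τ η) :=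
  kap_continuous (by simpa using hη.ne') (by simpa using hη.ne')

lemma qk_integrable (τ : ℝ) {η : ℝ} (hη : 0 < η) : Integrable (qk τ η) :=
  kap_integrable (by simpa using hη.ne') (by simpa using hη.ne')

lemma qk_poi_neg {τ η ε : ℝ} (hτ : τ ≠ 0) (hη : 0 < η) (hε : 0 < ε) (t : ℝ) :
    NegSpectralFun (fun s => poi ε s * qk τ η (t - s) - poi ε s * qk τ (η + ε) t) := by
  set z0 : ℂ := Complex.I * ε with hz0
  set a : ℂ := t - Complex.I * η with ha
  set b : ℂ := t - Complex.I * η - τ with hb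
  have h1 : NegSpectralFun (kap b (-z0)) := kap_neg (by simp [hb, hη]) (by simp [hz0, hε])
  have h2 : NegSpectralFun (kap a (-z0)) := kap_neg (by simp [ha, hη]) (by simp [hz0, hε])
  have hc := NegSpectralFun_comb h1 h2 (-((Real.pi : ℂ)⁻¹ * ε) * (τ : ℂ)⁻¹ * (b - z0)⁻¹)
    (((Real.pi : ℂ)⁻¹ * ε) * (τ : ℂ)⁻¹ * (a - z0)⁻¹)
  convert hc using 1
  ext s
  have him : ∀ z : ℂ, z.im ≠ 0 → z ≠ 0 := by
    rintro z hz rfl; simp at hz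
  have hτ' : (τ : ℂ) ≠ 0 := by exact_mod_cast hτ
  have n1 : (s : ℂ) - a ≠ 0 := him _ (by simp [ha, hη.ne'])
  have n2 : (s : ℂ) - b ≠ 0 := him _ (by simp [hb, hη.ne'])
  have n3 : (s : ℂ) - z0 ≠ 0 := him _ (by simp [hz0, hε.ne'])
  have n4 : (s : ℂ) + z0 ≠ 0 := him _ (by simp [hz0, hε.ne'])
  have n5 : a - z0 ≠ 0 := him _ (by simp [ha, hz0]; intro h; linarith)
  have n6 : b - z0 ≠ 0 := him _ (by simp [hb, hz0]; intro h; linarith)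
  rw [poi_eq hε]
  simp only [qk, kap]
  have e1 : ((t - s : ℝ) : ℂ) - Complex.I * η = -((s : ℂ) - a) := by
    push_cast; rw [ha]; ring
  have e2 : ((t - s : ℝ) : ℂ) - (Complex.I * η + τ) = -((s : ℂ) - b) := by
    push_cast; rw [hb]; ring
  have e3 : (t : ℂ) - Complex.I * ((η + ε : ℝ) : ℂ) = a - z0 := by
    push_cast; rw [ha, hz0]; ring
  have e4 : (t : ℂ) - (Complex.I * ((η + ε : ℝ) : ℂ) + τ) = b - z0 := by
    push_cast; rw [hb, hz0]; ring
  have hab : (τ : ℂ) = a - b := by rw [ha, hb]; ring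
  rw [e1, e2, e3, e4, sub_neg_eq_add, ← hz0]
  clear_value a b z0
  rw [hab] at hτ' ⊢
  generalize (Real.pi : ℂ)⁻¹ * ε = c
  field_simp
  ring

/-- Key Fubini computation. -/
lemma key_fubini {V W U : ℝ → H →L[ℂ] H} (hV : IsUnitaryOneParam V) (hW : IsUnitaryOneParam W)
    (hU : IsUnitaryOneParam U) (hUdef : ∀ t, U t = V t * W t) (hVpos : HasNonnegSpectrum V)
    {τ η ε : ℝ} (hτ : τ ≠ 0) (hη : 0 < η) (hε : 0 < ε) (φ : H) :
    intOp hU (poi_integrable hε) (intOp hW (qk_integrable τ hη) φ)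
      = intOp hV (poi_integrable hε) (intOp hW (qk_integrable τ (add_pos hη hε)) φ) := by
  have hjoint : Continuous (fun p : ℝ × ℝ => V p.1 (W p.2 φ)) := by
    rw [continuous_iff_continuousAt]
    rintro ⟨s0, t0⟩
    rw [ContinuousAt, tendsto_iff_norm_sub_tendsto_zero]
    have hc : Continuous (fun p : ℝ × ℝ => ‖W p.2 φ - W t0 φ‖
        + ‖V p.1 (W t0 φ) - V s0 (W t0 φ)‖) := by
      have c1 := (hW.2.2 φ).comp (continuous_snd (X := ℝ) (Y := ℝ))
      have c2 := (hV.2.2 (W t0 φ)).comp (continuous_fst (X := ℝ) (Y := ℝ))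
      exact (c1.sub continuous_const).norm.add (c2.sub continuous_const).norm
    have hl := hc.tendsto (s0, t0)
    simp only [sub_self, norm_zero, add_zero] at hl
    refine squeeze_zero (fun _ => norm_nonneg _) (fun p => ?_) hl
    have : V p.1 (W p.2 φ) - V s0 (W t0 φ)
        = V p.1 (W p.2 φ - W t0 φ) + (V p.1 (W t0 φ) - V s0 (W t0 φ)) := by
      rw [map_sub]; abel
    rw [this]
    refine (norm_add_le _ _).trans ?_
    rw [oneParam_norm_apply hV]
  have hfint : Integrable (Function.uncurry fun s t : ℝ =>
      (poi ε s * qk τ η (t - s)) • V s (W t φ)) (volume.prod volume) := by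
    have hci : Integrable (fun p : ℝ × ℝ => poi ε p.1 * qk τ η (p.2 - p.1))
        (volume.prod volume) := by
      have := ((poi_integrable hε).mul_prod (qk_integrable τ hη))
      have h2 := (measurePreserving_prod_neg_add (volume : Measure ℝ)
        (volume : Measure ℝ)).integrable_comp_of_integrable this
      refine h2.congr (Eventually.of_forall fun p => ?_)
      simp only [Function.comp]
      rw [neg_add_eq_sub]
    refine Integrable.mono (hci.smul_const φ) (Continuous.aestronglyMeasurable ?_)
      (Eventually.of_forall fun p => ?_)
    · have c1 := (poi_continuous hε).comp (continuous_fst (X := ℝ) (Y := ℝ))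
      have c2 := (qk_continuous τ hη).comp ((continuous_snd (X := ℝ) (Y := ℝ)).sub continuous_fst)
      exact (c1.mul c2).smul hjoint
    · simp only [Function.uncurry, norm_smul, oneParam_norm_apply hV, oneParam_norm_apply hW]
      exact le_rfl
  have step1 : ∀ s : ℝ, poi ε s • U s (intOp hW (qk_integrable τ hη) φ)
      = ∫ t, (poi ε s * qk τ η (t - s)) • V s (W t φ) := by
    intro s
    rw [intOp_apply, ← ContinuousLinearMap.integral_comp_comm _
      (intOp_integrable hW (qk_integrable τ hη) φ), ← integral_smul,
      ← integral_sub_right_eq_self _ s]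
    congr 1
    ext t
    rw [map_smul, smul_smul, hUdef, mul_apply_eq_comp, ← mul_apply_eq_comp (W s), ← hW.2.1,
      add_sub_cancel]
  have step2 : ∀ t : ℝ, (∫ s, (poi ε s * qk τ η (t - s)) • V s (W t φ))
      = intOp hV (poi_integrable hε) (qk τ (η + ε) t • W t φ) := by
    intro t
    have hn := qk_poi_neg hτ hη hε t
    have h0 := hVpos _ hn (W t φ)
    have i2 : Integrable (fun s => poi ε s * qk τ (η + ε) t) :=
      (poi_integrable hε).mul_const _
    have i1 : Integrable (fun s => poi ε s * qk τ η (t - s)) := by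
      have := hn.1.add i2
      refine this.congr (Eventually.of_forall fun s => ?_)
      simp
    simp only [sub_smul] at h0
    rw [integral_sub (intOp_integrable hV i1 _) (intOp_integrable hV i2 _), sub_eq_zero] at h0
    rw [h0, intOp_apply]
    congr 1
    ext s
    rw [map_smul, smul_smul]
  rw [intOp_apply hU]
  simp only [step1]
  rw [integral_integral_swap hfint]
  simp only [step2]
  rw [ContinuousLinearMap.integral_comp_comm _
    (intOp_integrable hW (qk_integrable τ (add_pos hη hε)) φ), intOp_apply hW]

lemma trivial_oneParam : IsUnitaryOneParam (fun _ : ℝ => (1 : H →L[ℂ] H)) :=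
  ⟨fun _ => one_mem _, fun _ _ => (mul_one _).symm, fun ψ => continuous_const⟩

lemma trivial_pos : HasNonnegSpectrum (fun _ : ℝ => (1 : H →L[ℂ] H)) := by
  intro f hf ψ
  have := hf.2 0 le_rfl
  simp at this
  rw [integral_smul_const, this, zero_smul]

lemma intOp_qk {W : ℝ → H →L[ℂ] H} (hW : IsUnitaryOneParam W) (hWpos : HasNonnegSpectrum W)
    {τ η : ℝ} (hη : 0 < η) (φ : H) :
    (τ : ℂ) • intOp hW (qk_integrable τ hη) φ = (2 * Complex.I * Real.pi) •
      (W τ (intOp hW (poi_integrable hη) φ) - intOp hW (poi_integrable hη) φ) := by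
  have hneg : NegSpectralFun (kap (-(Complex.I * η)) (-(Complex.I * η) + τ)) :=
    kap_neg (by simpa using hη) (by simpa using hη)
  have h0 := hWpos _ hneg φ
  have hsh : W τ (intOp hW (poi_integrable hη) φ) = ∫ t, poi η (t - τ) • W t φ := by
    rw [intOp_apply, ← ContinuousLinearMap.integral_comp_comm _
      (intOp_integrable hW (poi_integrable hη) φ), ← integral_sub_right_eq_self _ τ]
    congr 1
    ext t
    rw [map_smul, ← mul_apply_eq_comp, ← hW.2.1, add_sub_cancel]
  have e0 : (τ : ℂ) • intOp hW (qk_integrable τ hη) φ = (τ : ℂ) • (intOp hW (qk_integrable τ hη) φ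
      - ∫ t, kap (-(Complex.I * η)) (-(Complex.I * η) + τ) t • W t φ) := by
    rw [h0, sub_zero]
  rw [e0, hsh, intOp_apply, intOp_apply, ← integral_sub (intOp_integrable hW (qk_integrable τ hη) φ)
    (intOp_integrable hW hneg.1 φ), ← integral_sub
    (intOp_integrable hW ((poi_integrable hη).comp_sub_right τ) φ)
    (intOp_integrable hW (poi_integrable hη) φ), ← integral_smul, ← integral_smul]
  congr 1
  ext t
  rw [← sub_smul, ← sub_smul, smul_smul, smul_smul]
  congr 1
  have him : ∀ z : ℂ, z.im ≠ 0 → z ≠ 0 := by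
    rintro z hz rfl; simp at hz
  rw [poi_eq hη, poi_eq hη]
  simp only [qk, kap]
  have hpi : (Real.pi : ℂ) ≠ 0 := by exact_mod_cast Real.pi_ne_zero
  have n1 : (t : ℂ) - Complex.I * η ≠ 0 := him _ (by simp [hη.ne'])
  have n2 : (t : ℂ) + Complex.I * η ≠ 0 := him _ (by simp [hη.ne'])
  have n3 : (t : ℂ) - τ - Complex.I * η ≠ 0 := him _ (by simp [hη.ne'])
  have n4 : (t : ℂ) - τ + Complex.I * η ≠ 0 := him _ (by simp [hη.ne'])
  have e1 : (t : ℂ) - (Complex.I * η + τ) = t - τ - Complex.I * η := by ring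
  have e2 : (t : ℂ) - -(Complex.I * η) = t + Complex.I * η := by ring
  have e3 : (t : ℂ) - (-(Complex.I * η) + τ) = t - τ + Complex.I * η := by ring
  have e4 : ((t - τ : ℝ) : ℂ) = t - τ := by push_cast; rfl
  rw [e1, e2, e3, e4]
  have e5 : 2 * Complex.I * (Real.pi : ℂ) * ((Real.pi : ℂ)⁻¹ * η) = 2 * (Complex.I * η) := by
    field_simp
  rw [← mul_sub, ← mul_assoc, e5]
  generalize Complex.I * (η : ℂ) = w at *
  field_simp
  ring

lemma poi_strong {W : ℝ → H →L[ℂ] H} (hW : IsUnitaryOneParam W) (φ : H) :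
    ∃ g : ℝ → H, (∀ ε (hε : 0 < ε), g ε = intOp hW (poi_integrable hε) φ) ∧
      Tendsto g (𝓝[>] 0) (𝓝 φ) := by
  refine ⟨fun ε => ∫ t, poi ε t • W t φ, fun ε hε => rfl, ?_⟩
  have := poi_approx (fun t => W t φ) (hW.2.2 φ) ‖φ‖ (fun t => (oneParam_norm_apply hW t φ).le)
  simpa [oneParam_zero hW] using this

lemma intOp_poi_star {U : ℝ → H →L[ℂ] H} (hU : IsUnitaryOneParam U) {ε : ℝ} (hε : 0 < ε) :
    star (intOp hU (poi_integrable hε)) = intOp hU (poi_integrable hε) := by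
  have e : (fun t => star (poi ε (-t))) = poi ε := by
    ext t; rw [poi_neg_arg, poi_conj]
  have h : Integrable (fun t => star (poi ε (-t))) := by rw [e]; exact poi_integrable hε
  rw [intOp_star hU _ h]
  ext ψ
  rw [intOp_apply, intOp_apply]
  simp only [poi_neg_arg, poi_conj]

lemma poi_product {V W U : ℝ → H →L[ℂ] H} (hV : IsUnitaryOneParam V) (hW : IsUnitaryOneParam W)
    (hU : IsUnitaryOneParam U) (hUdef : ∀ t, U t = V t * W t)
    (hcomm : ∀ s t, V s * W t = W t * V s)
    (hVpos : HasNonnegSpectrum V) (hWpos : HasNonnegSpectrum W) {ε : ℝ} (hε : 0 < ε) :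
    intOp hU (poi_integrable hε) = intOp hV (poi_integrable hε) * intOp hW (poi_integrable hε) := by
  set TU := intOp hU (poi_integrable hε) with hTU
  set TV := intOp hV (poi_integrable hε) with hTV
  set TW := intOp hW (poi_integrable hε) with hTW
  have hWW : ∀ s t, W s * W t = W t * W s := fun s t => by
    rw [← hW.2.1, ← hW.2.1, add_comm]
  have c1 : ∀ τ, W τ * TU = TU * W τ := fun τ => intOp_comm hU _ _ fun t => by
    rw [hUdef, ← mul_assoc, ← hcomm, mul_assoc, hWW, mul_assoc]
  have c2 : ∀ τ, W τ * TV = TV * W τ := fun τ => intOp_comm hV _ _ fun t => (hcomm t τ).symm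
  have c3 : ∀ τ, W τ * TW = TW * W τ := fun τ => intOp_comm hW _ _ fun t => hWW τ t
  have c4 : TV * TW = TW * TV := intOp_comm hW _ _ fun t => (c2 t).symm
  set D := TU - TV * TW with hD
  have hDW : ∀ τ, W τ * D = D * W τ := fun τ => by
    rw [hD, mul_sub, sub_mul, c1, ← mul_assoc, c2, mul_assoc, c3, mul_assoc]
  have hDstar : star D = D := by
    rw [hD, star_sub, star_mul, intOp_poi_star hU hε, intOp_poi_star hV hε, intOp_poi_star hW hε,
      ← hTU, ← hTV, ← hTW, c4]
  -- `D` kills the range of `W(q)`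
  have hDq : ∀ τ η : ℝ, τ ≠ 0 → ∀ hη : 0 < η, ∀ φ,
      D (intOp hW (qk_integrable τ hη) φ) = 0 := by
    intro τ η hτ hη φ
    have k1 := key_fubini hV hW hU hUdef hVpos hτ hη hε φ
    have k2 := key_fubini trivial_oneParam hW hW (fun t => (one_mul _).symm) trivial_pos
      hτ hη hε φ
    have k3 : ∀ x : H, intOp (trivial_oneParam (H := H)) (poi_integrable hε) x = x := by
      intro x
      rw [intOp_apply]
      simp only [one_apply_eq_self]
      rw [integral_smul_const, poi_integral hε, one_smul]
    rw [k3] at k2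
    rw [hD, sub_apply, mul_apply_eq_comp, k1, hTW, k2, sub_self]
  have hDτ : ∀ τ φ, D (W τ φ) = D φ := by
    intro τ φ
    by_cases hτ : τ = 0
    · rw [hτ, oneParam_zero hW]; rfl
    obtain ⟨g, hg, hlim⟩ := poi_strong hW φ
    have hz : ∀ η > 0, D (W τ (g η)) - D (g η) = 0 := by
      intro η hη
      have h1 := congrArg D (intOp_qk hW hWpos (τ := τ) hη φ)
      rw [map_smul, hDq τ η hτ hη φ, smul_zero, map_smul, ← hg η hη] at h1
      have hne : (2 * Complex.I * Real.pi : ℂ) ≠ 0 := by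
        have hpi : (Real.pi : ℂ) ≠ 0 := by exact_mod_cast Real.pi_ne_zero
        simp [Real.pi_ne_zero]
      have h2 := (smul_eq_zero.1 h1.symm).resolve_left hne
      rwa [map_sub] at h2
    have l1 : Tendsto (fun η => D (W τ (g η)) - D (g η)) (𝓝[>] 0) (𝓝 (D (W τ φ) - D φ)) :=
      (((D.continuous.comp (W τ).continuous).tendsto φ).comp hlim).sub
        ((D.continuous.tendsto φ).comp hlim)
    have l2 : Tendsto (fun η => D (W τ (g η)) - D (g η)) (𝓝[>] 0) (𝓝 0) := by
      refine tendsto_const_nhds.congr' ?_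
      filter_upwards [self_mem_nhdsWithin] with η hη
      exact (hz η hη).symm
    exact sub_eq_zero.1 (tendsto_nhds_unique l1 l2)
  have hDD : ∀ φ, D (D φ) = 0 := by
    intro φ
    have hinv : ∀ τ, W τ (D φ) = D φ := fun τ => by
      rw [← mul_apply_eq_comp, hDW, mul_apply_eq_comp, hDτ]
    have e1 : TW (D φ) = D φ := by
      rw [hTW, intOp_apply]
      simp only [hinv]
      rw [integral_smul_const, poi_integral hε, one_smul]
    have e2 : TU (D φ) = TV (D φ) := by
      rw [hTU, hTV, intOp_apply, intOp_apply]
      simp only [hUdef, mul_apply_eq_comp, hinv]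
    have : D (D φ) = TU (D φ) - TV (TW (D φ)) := rfl
    rw [this, e1, e2, sub_self]
  have hD0 : D = 0 := by
    ext φ
    have : inner ℂ (D φ) (D φ) = 0 := by
      rw [← ContinuousLinearMap.adjoint_inner_right, ← ContinuousLinearMap.star_eq_adjoint,
        hDstar, hDD, inner_zero_right]
    simpa using this
  exact sub_eq_zero.1 hD0

lemma algU_subset_NCV {V W U : ℝ → H →L[ℂ] H} (hV : IsUnitaryOneParam V)
    (hW : IsUnitaryOneParam W) (hU : IsUnitaryOneParam U) (hUdef : ∀ t, U t = V t * W t)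
    (hcomm : ∀ s t, V s * W t = W t * V s)
    (hVpos : HasNonnegSpectrum V) (hWpos : HasNonnegSpectrum W) :
    integratedAlgebra (volume : Measure ℝ) U ⊆ NC V := by
  refine integratedAlgebra_induction hU hV fun f hf => ?_
  obtain ⟨g, hg, hlim⟩ := intOp_mul_eq hU (intOp_NC hU hf)
  refine (NC_closed hV).mem_of_tendsto hlim ?_
  filter_upwards [self_mem_nhdsWithin] with ε hε
  rw [hg ε hε, poi_product hV hW hU hUdef hcomm hVpos hWpos hε, mul_assoc]
  exact NC_mul (intOp_NC hV _) _

lemma NC_inter {V W U : ℝ → H →L[ℂ] H} (hV : IsUnitaryOneParam V) (hUdef : ∀ t, U t = V t * W t)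
    {T : H →L[ℂ] H} (h1 : T ∈ NC V) (h2 : T ∈ NC W) : T ∈ NC U := by
  have h : Tendsto (fun t => ‖W t * T - T‖ + ‖V t * T - T‖) (𝓝 0) (𝓝 0) := by
    simpa using Tendsto.add h2 h1
  refine squeeze_zero (fun _ => norm_nonneg _) (fun t => ?_) h
  have : U t * T - T = V t * (W t * T - T) + (V t * T - T) := by
    rw [hUdef, mul_sub, mul_assoc]; abel
  rw [this]
  refine (norm_add_le _ _).trans ?_
  have := oneParam_norm_mul hV t (W t * T - T)
  linarith

lemma key_cross {V W U : ℝ → H →L[ℂ] H} (hV : IsUnitaryOneParam V)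
    (hW : IsUnitaryOneParam W) (hU : IsUnitaryOneParam U) (hUdef : ∀ t, U t = V t * W t)
    (hcomm : ∀ s t, V s * W t = W t * V s)
    (hVpos : HasNonnegSpectrum V) (hWpos : HasNonnegSpectrum W)
    (m : H →L[ℂ] H) (hm : ∀ t, m * W t = W t * m)
    (h : ∀ L ∈ integratedAlgebra (volume : Measure ℝ) V,
      m * L ∈ closedRightSpan (integratedAlgebra (volume : Measure ℝ) V)) :
    ∀ L ∈ integratedAlgebra (volume : Measure ℝ) U,
      m * L ∈ closedRightSpan (integratedAlgebra (volume : Measure ℝ) U) := by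
  intro L hL
  have hUdef' : ∀ t, U t = W t * V t := fun t => by rw [hUdef, hcomm]
  have hLV : L ∈ NC V := algU_subset_NCV hV hW hU hUdef hcomm hVpos hWpos hL
  have hLW : L ∈ NC W := algU_subset_NCV hW hV hU hUdef' (fun s t => (hcomm t s).symm)
    hWpos hVpos hL
  apply NC_subset_closedRightSpan hU
  refine NC_inter hV hUdef ?_ ?_
  · exact closedRightSpan_mul hV m (fun L' hL' => closedRightSpan_subset_NC hV (h L' hL')) L
      (NC_subset_closedRightSpan hV hLV)
  · have h2 : Tendsto (fun t => ‖m‖ * ‖W t * L - L‖) (𝓝 0) (𝓝 0) := by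
      simpa using Tendsto.const_mul ‖m‖ hLW
    refine squeeze_zero (fun _ => norm_nonneg _) (fun t => ?_) h2
    rw [← mul_assoc, ← hm, mul_assoc, ← mul_sub]
    exact norm_mul_le _ _

/-- If `V ⊆ M` and `W ⊆ M′` are positive one-parameter unitary groups and
`U_t = V_t W_t`, then `U` is a strongly continuous one-parameter unitary group implementing
the same automorphisms of `M` as `V`, the `V`-cross-domain is contained in the
`U`-cross-domain, and cross for `V` implies cross for `U` (also for invariant
C*-subalgebras `A ⊆ M`). -/
theorem minimal_cross_implies_cross
    (M : VonNeumannAlgebra H)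
    (V W : ℝ → H →L[ℂ] H) (hV : IsUnitaryOneParam V) (hW : IsUnitaryOneParam W)
    (hVpos : HasNonnegSpectrum V) (hWpos : HasNonnegSpectrum W)
    (hVM : ∀ t : ℝ, V t ∈ M) (hWM : ∀ t : ℝ, W t ∈ M.commutant)
    (U : ℝ → H →L[ℂ] H) (hUdef : ∀ t : ℝ, U t = V t * W t) :
    IsUnitaryOneParam U ∧
    (∀ m ∈ M, ∀ t : ℝ, U t * m * star (U t) = V t * m * star (V t)) ∧
    ({m : H →L[ℂ] H | m ∈ M ∧ ∀ b ∈ ({m, star m} : Set (H →L[ℂ] H)),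
        ∀ L ∈ integratedAlgebra (volume : Measure ℝ) V,
          b * L ∈ closedRightSpan (integratedAlgebra (volume : Measure ℝ) V)} ⊆
      {m : H →L[ℂ] H | m ∈ M ∧ ∀ b ∈ ({m, star m} : Set (H →L[ℂ] H)),
        ∀ L ∈ integratedAlgebra (volume : Measure ℝ) U,
          b * L ∈ closedRightSpan (integratedAlgebra (volume : Measure ℝ) U)}) ∧
    (IsCrossRep (M : Set (H →L[ℂ] H)) (integratedAlgebra (volume : Measure ℝ) V) →
      IsCrossRep (M : Set (H →L[ℂ] H)) (integratedAlgebra (volume : Measure ℝ) U)) ∧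
    (∀ A : NonUnitalStarSubalgebra ℂ (H →L[ℂ] H), IsClosed (A : Set (H →L[ℂ] H)) →
      (A : Set (H →L[ℂ] H)) ⊆ (M : Set (H →L[ℂ] H)) →
      (∀ t : ℝ, (fun a => V t * a * star (V t)) '' (A : Set (H →L[ℂ] H)) = A) →
      (∀ t : ℝ, (fun a => U t * a * star (U t)) '' (A : Set (H →L[ℂ] H)) = A) →
      IsCrossRep (A : Set (H →L[ℂ] H)) (integratedAlgebra (volume : Measure ℝ) V) →
      IsCrossRep (A : Set (H →L[ℂ] H)) (integratedAlgebra (volume : Measure ℝ) U)) := by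
  have hcomm : ∀ m ∈ M, ∀ t, m * W t = W t * m := fun m hm t =>
    VonNeumannAlgebra.mem_commutant_iff.1 (hWM t) m hm
  have hVW : ∀ s t, V s * W t = W t * V s := fun s t => hcomm _ (hVM s) t
  have hU : IsUnitaryOneParam U := by
    refine ⟨fun t => ?_, fun s t => ?_, fun ψ => ?_⟩
    · rw [hUdef]; exact mul_mem (hV.1 t) (hW.1 t)
    · rw [hUdef, hUdef, hUdef, hV.2.1, hW.2.1, mul_assoc, mul_assoc, ← mul_assoc (V t),
        hVW t s, mul_assoc]
    · rw [continuous_iff_continuousAt]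
      intro t0
      rw [ContinuousAt, tendsto_iff_norm_sub_tendsto_zero]
      have hc : Continuous (fun t => ‖W t ψ - W t0 ψ‖ + ‖V t (W t0 ψ) - V t0 (W t0 ψ)‖) :=
        ((hW.2.2 ψ).sub continuous_const).norm.add
          ((hV.2.2 (W t0 ψ)).sub continuous_const).norm
      have hl := hc.tendsto t0
      simp only [sub_self, norm_zero, add_zero] at hl
      refine squeeze_zero (fun _ => norm_nonneg _) (fun t => ?_) hl
      have : U t ψ - U t0 ψ = V t (W t ψ - W t0 ψ) + (V t (W t0 ψ) - V t0 (W t0 ψ)) := by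
        rw [hUdef, hUdef, map_sub, mul_apply_eq_comp, mul_apply_eq_comp]; abel
      rw [this]
      refine (norm_add_le _ _).trans ?_
      rw [oneParam_norm_apply hV]
  have key := fun m (hm : m ∈ M) =>
    key_cross hV hW hU hUdef hVW hVpos hWpos m (hcomm m hm)
  refine ⟨hU, ?_, ?_, ?_, ?_⟩
  · intro m hm t
    have h1 : W t * star (W t) = 1 := Unitary.mul_star_self_of_mem (hW.1 t)
    rw [hUdef, star_mul]
    calc V t * W t * m * (star (W t) * star (V t))
        = V t * (W t * m) * star (W t) * star (V t) := by simp only [mul_assoc]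
      _ = V t * (m * W t) * star (W t) * star (V t) := by rw [hcomm m hm]
      _ = V t * m * (W t * star (W t)) * star (V t) := by simp only [mul_assoc]
      _ = V t * m * star (V t) := by rw [h1, mul_one]
  · rintro m ⟨hm, hb⟩
    refine ⟨hm, fun b hbm => ?_⟩
    have hbM : b ∈ M := by
      rcases hbm with rfl | rfl
      · exact hm
      · exact star_mem hm
    exact key b hbM (hb b hbm)
  · intro h a ha
    exact key a ha (h a ha)
  · intro A _ hAM _ _ h a ha
    exact key a (hAM ha) (h a ha)
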